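/- Let (X₀, X₁)_X be a pair of compatible metric spaces with X₀ ∩ X₁ ≠ ∅, let θ ∈ (0, 1) and q ∈ [1, ∞]. Then for all x, y ∈ X₀ ∩ X₁, δ_{θ,q}(x, y) ≤ P_{θ,q}(x, y) ≤ J_M(1; x, y). -/

import Mathlib

open scoped ENNReal Classical

/-- A function `d` is a metric on the subset `A` of `X`. -/
structure IsMetricOn {X : Type*} (d : X → X → ℝ) (A : Set X) : Prop where
  refl : ∀ x ∈ A, d x x = 0
  eq_of_dist_eq_zero : ∀ x ∈ A, ∀ y ∈ A, d x y = 0 → x = y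
  symm : ∀ x ∈ A, ∀ y ∈ A, d x y = d y x
  triangle : ∀ x ∈ A, ∀ y ∈ A, ∀ z ∈ A, d x z ≤ d x y + d y z

/-- A pair of compatible metric spaces `(X₀, X₁)_X` inside an ambient metric space `X`. -/
structure CompatiblePair (X : Type*) [MetricSpace X] where
  X0 : Set X
  X1 : Set X
  d0 : X → X → ℝ
  d1 : X → X → ℝ
  inter_nonempty : (X0 ∩ X1).Nonempty
  met0 : IsMetricOn d0 X0
  met1 : IsMetricOn d1 X1
  C0 : ℝ
  C1 : ℝ
  C0_pos : 0 < C0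
  C1_pos : 0 < C1
  compat0 : ∀ x ∈ X0, ∀ y ∈ X0, dist x y ≤ C0 * d0 x y
  compat1 : ∀ x ∈ X1, ∀ y ∈ X1, dist x y ≤ C1 * d1 x y

namespace CompatiblePair

variable {X : Type*} [MetricSpace X] (P : CompatiblePair X)

/-- The `J_M` functional: `J_M(t; x, y) = max {d₀(x,y), t·d₁(x,y)}`. -/
noncomputable def JM (t : ℝ) (x y : X) : ℝ := max (P.d0 x y) (t * P.d1 x y)

/-- The cost function `h_t` on pairs in `X₀² ∪ X₁²`. -/
noncomputable def hFun (t : ℝ) (x y : X) : ℝ :=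
  if x ∈ P.X0 ∩ P.X1 ∧ y ∈ P.X0 ∩ P.X1 then min (P.d0 x y) (t * P.d1 x y)
  else if x ∈ P.X0 ∧ y ∈ P.X0 then P.d0 x y
  else t * P.d1 x y

/-- `f 0 = x, …, f n = y` is an admissible linking sequence from `x` to `y` in `X₀ ∪ X₁`. -/
def IsAdmissibleChain (x y : X) (n : ℕ) (f : ℕ → X) : Prop :=
  f 0 = x ∧ f n = y ∧ (∀ k ≤ n, f k ∈ P.X0 ∪ P.X1) ∧
    ∀ k < n, (f k ∈ P.X0 ∧ f (k + 1) ∈ P.X0) ∨ (f k ∈ P.X1 ∧ f (k + 1) ∈ P.X1)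

/-- The `K_M` functional: infimum of `∑ h_t` over admissible linking sequences. -/
noncomputable def KM (t : ℝ) (x y : X) : ℝ :=
  sInf { s : ℝ | ∃ n f, P.IsAdmissibleChain x y n f ∧
    s = ∑ k ∈ Finset.range n, P.hFun t (f k) (f (k + 1)) }

end CompatiblePair

/-- The functional `Γ_{θ,q}` of a bi-infinite real sequence, valued in `[0,∞]`. -/
noncomputable def GammaE (θ : ℝ) (q : ℝ≥0∞) (x : ℤ → ℝ) : ℝ≥0∞ :=
  if q = ∞ then ⨆ k : ℤ, ENNReal.ofReal ((2 : ℝ) ^ (-(k : ℝ) * θ) * |x k|)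
  else (∑' k : ℤ, ENNReal.ofReal ((2 : ℝ) ^ (-(k : ℝ) * θ) * |x k|) ^ q.toReal) ^ (1 / q.toReal)

/-- The real-valued functional `Γ_{θ,q}`. -/
noncomputable def Gamma (θ : ℝ) (q : ℝ≥0∞) (x : ℤ → ℝ) : ℝ := (GammaE θ q x).toReal

/-- The constant `M_{θ,q} = Γ_{θ,q}((min{1, 2^k})_k)`. -/
noncomputable def MThetaQ (θ : ℝ) (q : ℝ≥0∞) : ℝ :=
  Gamma θ q (fun k : ℤ => min 1 ((2 : ℝ) ^ k))

/-- The constant `M'_{θ,q} = (∑_j (2^{jθ} min{1,2^{-j}})^p)^{1/p}` (with `p` the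
conjugate exponent of `q`, and the supremum modification for `p = ∞`). -/
noncomputable def MConst' (θ : ℝ) (p : ℝ≥0∞) : ℝ :=
  (if p = ∞ then ⨆ j : ℤ, ENNReal.ofReal ((2 : ℝ) ^ ((j : ℝ) * θ) * min 1 ((2 : ℝ) ^ (-(j : ℝ))))
   else (∑' j : ℤ,
      ENNReal.ofReal ((2 : ℝ) ^ ((j : ℝ) * θ) * min 1 ((2 : ℝ) ^ (-(j : ℝ)))) ^ p.toReal) ^
        (1 / p.toReal)).toReal

/-- The `ℓ^q` norm of a bi-infinite real sequence, valued in `[0,∞]`. -/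
noncomputable def lqNorm (q : ℝ≥0∞) (c : ℤ → ℝ) : ℝ≥0∞ :=
  if q = ∞ then ⨆ k : ℤ, ENNReal.ofReal |c k|
  else (∑' k : ℤ, ENNReal.ofReal |c k| ^ q.toReal) ^ (1 / q.toReal)

namespace CompatiblePair

variable {X : Type*} [MetricSpace X] (P : CompatiblePair X)

/-- The metric `β_{θ,q}(x,y) = Γ_{θ,q}((K_M(2^k; x, y))_k)` on `X₀ ∩ X₁`. -/
noncomputable def beta (θ : ℝ) (q : ℝ≥0∞) (x y : X) : ℝ :=
  Gamma θ q (fun k : ℤ => P.KM ((2 : ℝ) ^ k) x y)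

/-- `u` is an approximating sequence of `x` in `(X₀ ∩ X₁, J_M(1))`: a sequence in
`X₀ ∩ X₁`, Cauchy for `J_M(1)`, with `K_M(1; uₙ, x) → 0`. -/
def IsApproxSeq (x : X) (u : ℕ → X) : Prop :=
  (∀ n, u n ∈ P.X0 ∩ P.X1) ∧
  (∀ ε > 0, ∃ N, ∀ m ≥ N, ∀ n ≥ N, P.JM 1 (u m) (u n) < ε) ∧
  Filter.Tendsto (fun n => P.KM 1 (u n) x) Filter.atTop (nhds 0)

/-- The bi-infinite linking sequence `S_k = u_k` for `k ≥ 0`, `S_k = v_{-k}` for `k < 0`. -/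
noncomputable def linkSeq (u v : ℕ → X) : ℤ → X :=
  fun k => if 0 ≤ k then u k.toNat else v (-k).toNat

/-- The functional `p_{θ,q}` valued in `[0,∞]`: infimum of
`Γ_{θ,q}((J_M(2^k; S_k, S_{k+1}))_k)` over approximating sequences of `x` and `y`. -/
noncomputable def pFunE (θ : ℝ) (q : ℝ≥0∞) (x y : X) : ℝ≥0∞ :=
  ⨅ (u : ℕ → X) (v : ℕ → X) (_ : P.IsApproxSeq x u) (_ : P.IsApproxSeq y v),
    GammaE θ q (fun k : ℤ =>
      P.JM ((2 : ℝ) ^ k) (linkSeq u v k) (linkSeq u v (k + 1)))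

/-- The real-valued functional `p_{θ,q}`. -/
noncomputable def pFun (θ : ℝ) (q : ℝ≥0∞) (x y : X) : ℝ := (P.pFunE θ q x y).toReal

/-- The symmetrization `P_{θ,q}(x,y) = (p_{θ,q}(x,y) + p_{θ,q}(y,x))/2`. -/
noncomputable def PFun (θ : ℝ) (q : ℝ≥0∞) (x y : X) : ℝ :=
  (P.pFun θ q x y + P.pFun θ q y x) / 2

/-- The metric `δ_{θ,q}`: infimum of `∑ P_{θ,q}` over finite chains in `X₀ ∩ X₁`. -/
noncomputable def delta (θ : ℝ) (q : ℝ≥0∞) (x y : X) : ℝ :=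
  sInf { s : ℝ | ∃ (n : ℕ) (f : ℕ → X), f 0 = x ∧ f n = y ∧
    (∀ k ≤ n, f k ∈ P.X0 ∩ P.X1) ∧
    s = ∑ j ∈ Finset.range n, P.PFun θ q (f j) (f (j + 1)) }

end CompatiblePair

/-- A metric on a subset is nonnegative there. -/
theorem IsMetricOn.nonneg {X : Type*} {d : X → X → ℝ} {A : Set X} (h : IsMetricOn d A)
    {x y : X} (hx : x ∈ A) (hy : y ∈ A) : 0 ≤ d x y := by
  have h1 := h.triangle x hx y hy x hx
  rw [h.refl x hx, ← h.symm x hx y hy] at h1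
  linarith

/-- `Γ_{θ,q}` of a sequence supported at `0` is the modulus of its value there. -/
theorem GammaE_eq_of_support_zero {θ : ℝ} {q : ℝ≥0∞} (hq : 1 ≤ q) {a : ℤ → ℝ}
    (ha : ∀ k, k ≠ 0 → a k = 0) : GammaE θ q a = ENNReal.ofReal |a 0| := by
  unfold GammaE
  split_ifs with hqt
  · apply le_antisymm
    · refine iSup_le fun k => ?_
      by_cases hk : k = 0
      · simp [hk]
      · simp [ha k hk]
    · exact le_iSup_of_le 0 (by simp)
  · have hpos : 0 < q.toReal := ENNReal.toReal_pos (zero_lt_one.trans_le hq).ne' hqt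
    rw [tsum_eq_single 0 (fun k hk => by simp [ha k hk, hpos]), one_div,
      ENNReal.rpow_rpow_inv hpos.ne']
    simp

namespace CompatiblePair

theorem linkSeq_update_const {X : Type*} (x y : X) (k : ℤ) :
    linkSeq (Function.update (fun _ => x) 0 y) (fun _ => y) k = if k ≤ 0 then y else x := by
  unfold linkSeq
  rcases lt_trichotomy k 0 with hk | rfl | hk
  · simp [hk.not_ge, hk.le]
  · simp
  · simp [hk.le, hk.not_ge]

variable {X : Type*} [MetricSpace X] (P : CompatiblePair X)

theorem JM_self (t : ℝ) {x : X} (hx : x ∈ P.X0 ∩ P.X1) : P.JM t x x = 0 := by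
  simp [JM, P.met0.refl x hx.1, P.met1.refl x hx.2]

theorem JM_nonneg (t : ℝ) {x y : X} (hx : x ∈ P.X0) (hy : y ∈ P.X0) : 0 ≤ P.JM t x y :=
  le_max_of_le_left (P.met0.nonneg hx hy)

theorem JM_comm (t : ℝ) {x y : X} (hx : x ∈ P.X0 ∩ P.X1) (hy : y ∈ P.X0 ∩ P.X1) :
    P.JM t x y = P.JM t y x := by
  simp only [JM, P.met0.symm x hx.1 y hy.1, P.met1.symm x hx.2 y hy.2]

theorem hFun_nonneg {t : ℝ} (ht : 0 ≤ t) {x y : X}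
    (h : (x ∈ P.X0 ∧ y ∈ P.X0) ∨ (x ∈ P.X1 ∧ y ∈ P.X1)) : 0 ≤ P.hFun t x y := by
  unfold hFun
  split_ifs with h1 h2
  · exact le_min (P.met0.nonneg h1.1.1 h1.2.1)
      (mul_nonneg ht (P.met1.nonneg h1.1.2 h1.2.2))
  · exact P.met0.nonneg h2.1 h2.2
  · have h3 := h.resolve_left h2
    exact mul_nonneg ht (P.met1.nonneg h3.1 h3.2)

theorem KM_self {t : ℝ} (ht : 0 ≤ t) {x : X} (hx : x ∈ P.X0 ∪ P.X1) : P.KM t x x = 0 := by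
  refine IsLeast.csInf_eq ⟨⟨0, fun _ => x, ⟨rfl, rfl, fun _ _ => hx, ?_⟩, by simp⟩, ?_⟩
  · simp
  · rintro s ⟨n, f, hf, rfl⟩
    exact Finset.sum_nonneg fun k hk =>
      P.hFun_nonneg ht (hf.2.2.2 k (Finset.mem_range.mp hk))

/-- A sequence in `X₀ ∩ X₁` which is eventually equal to `x` is an approximating sequence of `x`. -/
theorem isApproxSeq_of_eventually_eq {x : X} {u : ℕ → X} (hu : ∀ n, u n ∈ P.X0 ∩ P.X1) {N : ℕ}
    (h : ∀ n ≥ N, u n = x) : P.IsApproxSeq x u := by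
  have hx : x ∈ P.X0 ∩ P.X1 := h N le_rfl ▸ hu N
  refine ⟨hu, fun ε hε => ⟨N, fun m hm n hn => ?_⟩, ?_⟩
  · rwa [h m hm, h n hn, P.JM_self 1 hx]
  · refine tendsto_const_nhds.congr' ?_
    filter_upwards [Filter.eventually_ge_atTop N] with n hn
    rw [h n hn, P.KM_self zero_le_one (Or.inl hx.1)]

/-- Placing the jump from `y` to `x` at index `0` bounds `p_{θ,q}(x, y)` by `J_M(1; x, y)`. -/
theorem pFunE_le_JM_one (θ : ℝ) {q : ℝ≥0∞} (hq : 1 ≤ q) {x y : X}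
    (hx : x ∈ P.X0 ∩ P.X1) (hy : y ∈ P.X0 ∩ P.X1) :
    P.pFunE θ q x y ≤ ENNReal.ofReal (P.JM 1 x y) := by
  have hu : P.IsApproxSeq x (Function.update (fun _ => x) 0 y) := by
    refine P.isApproxSeq_of_eventually_eq (N := 1) (fun n => ?_) fun n hn => ?_
    · rw [Function.update_apply]
      split_ifs <;> assumption
    · rw [Function.update_of_ne (by omega)]
  have hv : P.IsApproxSeq y fun _ => y :=
    P.isApproxSeq_of_eventually_eq (N := 0) (fun _ => hy) fun _ _ => rfl
  refine (iInf₂_le_of_le _ _ (iInf₂_le_of_le hu hv le_rfl)).trans ?_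
  rw [GammaE_eq_of_support_zero hq]
  · simp [linkSeq_update_const, P.JM_comm 1 hx hy, abs_of_nonneg (P.JM_nonneg 1 hy.1 hx.1)]
  · intro k hk
    simp only [linkSeq_update_const]
    rcases lt_or_gt_of_ne hk with hk | hk
    · rw [if_pos hk.le, if_pos (by omega), P.JM_self _ hy]
    · rw [if_neg (by omega), if_neg (by omega), P.JM_self _ hx]

theorem pFun_le_JM_one (θ : ℝ) {q : ℝ≥0∞} (hq : 1 ≤ q) {x y : X}
    (hx : x ∈ P.X0 ∩ P.X1) (hy : y ∈ P.X0 ∩ P.X1) : P.pFun θ q x y ≤ P.JM 1 x y :=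
  ENNReal.toReal_le_of_le_ofReal (P.JM_nonneg 1 hx.1 hy.1) (P.pFunE_le_JM_one θ hq hx hy)

theorem PFun_nonneg (θ : ℝ) (q : ℝ≥0∞) (x y : X) : 0 ≤ P.PFun θ q x y :=
  div_nonneg (add_nonneg ENNReal.toReal_nonneg ENNReal.toReal_nonneg) zero_le_two

theorem delta_le_PFun (θ : ℝ) (q : ℝ≥0∞) {x y : X}
    (hx : x ∈ P.X0 ∩ P.X1) (hy : y ∈ P.X0 ∩ P.X1) : P.delta θ q x y ≤ P.PFun θ q x y := by
  refine csInf_le ⟨0, ?_⟩ ⟨1, fun n => if n = 0 then x else y, by simp, by simp, ?_, by simp⟩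
  · rintro s ⟨n, f, -, -, -, rfl⟩
    exact Finset.sum_nonneg fun _ _ => P.PFun_nonneg θ q _ _
  · intro k _
    dsimp only
    split_ifs <;> assumption

end CompatiblePair

/-- `δ_{θ,q}(x, y) ≤ P_{θ,q}(x, y) ≤ J_M(1; x, y)` on `X₀ ∩ X₁`. -/
theorem delta_le_PFun_le_JM_one {X : Type*} [MetricSpace X] (P : CompatiblePair X)
    (θ : ℝ) (hθ : θ ∈ Set.Ioo (0 : ℝ) 1) (q : ℝ≥0∞) (hq : 1 ≤ q) :
    ∀ x ∈ P.X0 ∩ P.X1, ∀ y ∈ P.X0 ∩ P.X1,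
      P.delta θ q x y ≤ P.PFun θ q x y ∧ P.PFun θ q x y ≤ P.JM 1 x y := by
  intro x hx y hy
  refine ⟨P.delta_le_PFun θ q hx hy, ?_⟩
  have h1 := P.pFun_le_JM_one θ hq hx hy
  have h2 := P.pFun_le_JM_one θ hq hy hx
  rw [P.JM_comm 1 hy hx] at h2
  unfold CompatiblePair.PFun
  linarith
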